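/- arXiv:2212.07281 — 2 statements merged into one kernel-verified Lean document; each statement's English description precedes it below -/
import Mathlib

section
/- Let n ≥ 1 and 1 ≤ r ≤ n, let V ∈ ℝ^{n×r} satisfy VᵀV = I_r, let Σ ∈ ℝ^{r×r} be invertible, let ṽ ∈ ℝ^r, and let 𝟙 ∈ ℝ^n denote the vector of all ones. Set s = n − ‖Vᵀ𝟙‖₂² and assume s ≠ 0. Define x = V Σ⁻¹ ṽ ∈ ℝ^n and c = x + (⟨𝟙, x⟩ / s) (V (Vᵀ𝟙) − 𝟙) ∈ ℝ^n. Then c solves the augmented linear system Σ Vᵀ c = ṽ and ⟨𝟙, c⟩ = 0, and c has minimal Euclidean norm among all solutions: for every c' ∈ ℝ^n with Σ Vᵀ c' = ṽ and ⟨𝟙, c'⟩ = 0 one has ‖c‖₂ ≤ ‖c'‖₂, with equality only if c' = c. -/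
open Matrix

/-- A vector orthogonal to its difference with another vector has the smaller Euclidean norm,
strictly so unless the two vectors agree. -/
theorem sqrt_dotProduct_le_of_dotProduct_sub_eq_zero {ι : Type*} [Fintype ι] {c d : ι → ℝ}
    (h : c ⬝ᵥ (d - c) = 0) :
    Real.sqrt (c ⬝ᵥ c) ≤ Real.sqrt (d ⬝ᵥ d) ∧
      (Real.sqrt (c ⬝ᵥ c) = Real.sqrt (d ⬝ᵥ d) → d = c) := by
  have nonneg (v : ι → ℝ) : 0 ≤ v ⬝ᵥ v := Finset.sum_nonneg fun i _ => mul_self_nonneg (v i)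
  have pythagoras : d ⬝ᵥ d = c ⬝ᵥ c + (d - c) ⬝ᵥ (d - c) := by
    simp only [dotProduct_sub, sub_dotProduct, dotProduct_comm d c] at h ⊢
    linarith
  refine ⟨Real.sqrt_le_sqrt (by linarith [nonneg (d - c)]), fun heq => ?_⟩
  have hsq := (Real.sqrt_inj (nonneg c) (nonneg d)).mp heq
  exact sub_eq_zero.mp (dotProduct_self_eq_zero.mp (by linarith))

/-- Closed-form minimum 2-norm solution of the augmented underdetermined system
`Σ Vᵀ c = ṽ`, `⟨𝟙, c⟩ = 0`, where `V` has orthonormal columns and `Σ` is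
invertible: the vector `c = x + (⟨𝟙, x⟩ / s) (V Vᵀ 𝟙 − 𝟙)` with
`x = V Σ⁻¹ ṽ` and `s = n − ‖Vᵀ𝟙‖₂²` solves the system and has minimal
Euclidean norm among all solutions, uniquely so. -/
theorem min_norm_solution_closed_form
    {n r : ℕ} (hn : 1 ≤ n) (hr : 1 ≤ r) (hrn : r ≤ n)
    (V : Matrix (Fin n) (Fin r) ℝ) (hV : Vᵀ * V = 1)
    (S : Matrix (Fin r) (Fin r) ℝ) (hS : IsUnit S.det)
    (vt : Fin r → ℝ)
    (ones : Fin n → ℝ) (hones : ones = fun _ => 1)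
    (s : ℝ) (hs_def : s = (n : ℝ) - (Vᵀ.mulVec ones) ⬝ᵥ (Vᵀ.mulVec ones))
    (hs : s ≠ 0)
    (x : Fin n → ℝ) (hx : x = V.mulVec (S⁻¹.mulVec vt))
    (c : Fin n → ℝ)
    (hc : c = x + ((ones ⬝ᵥ x) / s) • (V.mulVec (Vᵀ.mulVec ones) - ones)) :
    S.mulVec (Vᵀ.mulVec c) = vt ∧ ones ⬝ᵥ c = 0 ∧
    ∀ c' : Fin n → ℝ, S.mulVec (Vᵀ.mulVec c') = vt → ones ⬝ᵥ c' = 0 →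
      Real.sqrt (c ⬝ᵥ c) ≤ Real.sqrt (c' ⬝ᵥ c') ∧
      (Real.sqrt (c ⬝ᵥ c) = Real.sqrt (c' ⬝ᵥ c') → c' = c) := by
  have hVV (w : Fin r → ℝ) : Vᵀ *ᵥ (V *ᵥ w) = w := by
    rw [mulVec_mulVec, hV, one_mulVec]
  have hadj (w : Fin r → ℝ) (y : Fin n → ℝ) : (V *ᵥ w) ⬝ᵥ y = w ⬝ᵥ (Vᵀ *ᵥ y) := by
    rw [dotProduct_mulVec, vecMul_transpose]
  have hones_sq : ones ⬝ᵥ ones = n := by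
    simp [hones, dotProduct]
  have hVc : Vᵀ *ᵥ c = S⁻¹ *ᵥ vt := by
    rw [hc, mulVec_add, mulVec_smul, mulVec_sub, hx, hVV, hVV, sub_self, smul_zero, add_zero]
  have hones_c : ones ⬝ᵥ c = 0 := by
    have hs_neg : ones ⬝ᵥ (V *ᵥ (Vᵀ *ᵥ ones) - ones) = -s := by
      rw [dotProduct_sub, dotProduct_comm, hadj, hones_sq, hs_def]
      ring
    rw [hc, dotProduct_add, dotProduct_smul, hs_neg, smul_eq_mul]
    field_simp
    ring
  refine ⟨by rw [hVc, mulVec_mulVec, mul_nonsing_inv _ hS, one_mulVec], hones_c,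
    fun c' hc' hones_c' => sqrt_dotProduct_le_of_dotProduct_sub_eq_zero ?_⟩
  have hV_sub : Vᵀ *ᵥ (c' - c) = 0 := by
    rw [mulVec_sub, hVc, ← hc', mulVec_mulVec, nonsing_inv_mul _ hS, one_mulVec, sub_self]
  have hones_sub : ones ⬝ᵥ (c' - c) = 0 := by
    rw [dotProduct_sub, hones_c', hones_c, sub_self]
  generalize c' - c = d at hV_sub hones_sub ⊢
  rw [hc, hx, add_dotProduct, smul_dotProduct, sub_dotProduct, hadj, hadj, hV_sub, hones_sub]
  simp
end

section
/- (Karcher's gradient formula, instance on the unit sphere.) Let E be a real inner product space and let p, q ∈ E with ‖p‖ = ‖q‖ = 1 and −1 < ⟨q, p⟩ < 1. Let γ : ℝ → E be differentiable at 0 with ‖γ(t)‖ = 1 for all t and γ(0) = q, and write v = γ'(0). Then the squared-distance function along γ, t ↦ ½ arccos(⟨γ(t), p⟩)², is differentiable at 0 with derivative ⟨−Log_q(p), v⟩, where Log_q(p) = arccos(⟨q, p⟩) · (p − ⟨q, p⟩ q)/‖p − ⟨q, p⟩ q‖. That is, the Riemannian gradient of q ↦ ½ dist(q, p)² on the sphere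 is −Log_q(p). -/
open RealInnerProductSpace

/-- A differentiable curve of constant norm is orthogonal to its velocity. -/
theorem HasDerivAt.inner_eq_zero_of_norm_const
    {E : Type*} [NormedAddCommGroup E] [InnerProductSpace ℝ E]
    {γ : ℝ → E} {v : E} {t r : ℝ} (hγd : HasDerivAt γ v t) (hγ : ∀ s, ‖γ s‖ = r) :
    ⟪γ t, v⟫ = 0 := by
  have h := hγd.inner ℝ hγd
  have hconst : (fun s => ⟪γ s, γ s⟫) = fun _ => r ^ 2 := by
    funext s
    rw [real_inner_self_eq_norm_sq, hγ s]
  rw [hconst] at h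
  have h0 := h.unique (hasDerivAt_const t (r ^ 2))
  rw [real_inner_comm (γ t) v] at h0
  linarith

/-- The length of the component of a unit vector `p` orthogonal to a unit vector `q`. -/
theorem norm_sub_inner_smul_eq_sqrt
    {E : Type*} [NormedAddCommGroup E] [InnerProductSpace ℝ E]
    {p q : E} (hp : ‖p‖ = 1) (hq : ‖q‖ = 1) :
    ‖p - ⟪q, p⟫ • q‖ = √(1 - ⟪q, p⟫ ^ 2) := by
  rw [← Real.sqrt_sq (norm_nonneg (p - ⟪q, p⟫ • q)), norm_sub_sq_real, inner_smul_right,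
    real_inner_comm q p, norm_smul, hp, hq, Real.norm_eq_abs, mul_one, sq_abs]
  congr 1
  ring

/-- Karcher's gradient formula on the unit sphere: along any unit-speed-free
curve `γ` on the sphere with `γ(0) = q` and `γ'(0) = v`, the squared geodesic
distance function `t ↦ ½ arccos(⟨γ(t), p⟩)²` has derivative `⟨-Log_q(p), v⟩` at
`t = 0`; i.e. the Riemannian gradient of `q ↦ ½ dist(q, p)²` is `-Log_q(p)`. -/
theorem karcher_gradient_sphere
    {E : Type*} [NormedAddCommGroup E] [InnerProductSpace ℝ E]
    (p q : E) (hp : ‖p‖ = 1) (hq : ‖q‖ = 1)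
    (h1 : -1 < ⟪q, p⟫) (h2 : ⟪q, p⟫ < 1)
    (γ : ℝ → E) (hγ : ∀ t, ‖γ t‖ = 1) (hγ0 : γ 0 = q)
    (v : E) (hγd : HasDerivAt γ v 0) :
    HasDerivAt (fun t : ℝ => (1/2 : ℝ) * (Real.arccos ⟪γ t, p⟫) ^ 2)
      ⟪-(Real.arccos ⟪q, p⟫ • (‖p - ⟪q, p⟫ • q‖⁻¹ • (p - ⟪q, p⟫ • q))), v⟫ 0 := by
  have hqv : ⟪q, v⟫ = 0 := hγ0 ▸ hγd.inner_eq_zero_of_norm_const hγ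
  have hinner : HasDerivAt (fun t => ⟪γ t, p⟫) ⟪v, p⟫ 0 := by
    simpa using hγd.inner ℝ (hasDerivAt_const (0 : ℝ) p)
  have harccos : HasDerivAt Real.arccos (-(1 / √(1 - ⟪q, p⟫ ^ 2))) ⟪γ 0, p⟫ := by
    rw [hγ0]
    exact Real.hasDerivAt_arccos h1.ne' h2.ne
  refine (((harccos.comp (0 : ℝ) hinner).pow 2).const_mul (1 / 2 : ℝ)).congr_deriv ?_
  rw [norm_sub_inner_smul_eq_sqrt hp hq]
  simp only [inner_neg_left, real_inner_smul_left, inner_sub_left, hqv, real_inner_comm p v,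
    Function.comp_apply, hγ0]
  push_cast
  ring
end
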